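/- Let d ≥ 3 be an integer. There is a constant C = C(d) such that for every j ∈ ℕ, with Λ = 2^j and N = Λ^{1/2}, and every f ∈ l¹(ℤ^d), ‖ sup_{λ ∈ ℕ ∩ [Λ, 2Λ)} |E_{m,λ} f| ‖_{l¹(ℤ^d)} ≤ C N² ‖f‖_{l¹(ℤ^d)}. -/

import Mathlib

open scoped ENNReal NNReal BigOperators Real
open MeasureTheory

noncomputable section

/-- `ℤ^d` -/
abbrev V (d : ℕ) := Fin d → ℤ

/-- The sphere `{(u,v) ∈ ℤ^d × ℤ^d : |u|² + |v|² = λ}`. -/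
def sph (d lam : ℕ) : Set (V d × V d) :=
  {uv | (∑ i, uv.1 i ^ 2) + (∑ i, uv.2 i ^ 2) = (lam : ℤ)}

/-- `N(λ)`, the number of lattice points on the sphere of radius `λ^{1/2}` in `ℝ^{2d}`. -/
def Ncount (d lam : ℕ) : ℕ := Nat.card (sph d lam)

/-- `e(t) = e^{2πit}`. -/
def eC (t : ℝ) : ℂ := Complex.exp (2 * Real.pi * Complex.I * t)

/-- The quadratic Weyl sum `S_N(θ,ξ) = Σ_{u ∈ ℤ, 0 ≤ u ≤ N} e(θu² + ξu)`. -/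
def SN (N θ ξ : ℝ) : ℂ :=
  ∑ u ∈ Finset.range (⌊N⌋₊ + 1), eC (θ * (u : ℝ) ^ 2 + ξ * (u : ℝ))

/-- `F_N(θ,ξ) = Π_{i=1}^d S_N(θ,ξ_i)` for `ξ ∈ ℝ^d`. -/
def FN (d : ℕ) (N θ : ℝ) (ξ : Fin d → ℝ) : ℂ := ∏ i, SN N θ (ξ i)

/-- `F_N(θ) = S_N(θ,0)^d`. -/
def FN0 (d : ℕ) (N θ : ℝ) : ℂ := SN N θ 0 ^ d

/-- The major arcs at scale `N`:
`M_N = ∪_{1 ≤ q ≤ N} ∪_{1 ≤ a ≤ q, (a,q)=1} {θ ∈ [0,1] : |θ - a/q| ≤ 1/(8qN)}`. -/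
def majorArcs (N : ℝ) : Set ℝ :=
  ⋃ (q : ℕ) (_ : 1 ≤ q ∧ (q : ℝ) ≤ N) (a : ℕ) (_ : 1 ≤ a ∧ a ≤ q ∧ Nat.gcd a q = 1),
    {θ : ℝ | θ ∈ Set.Icc (0 : ℝ) 1 ∧ |θ - (a : ℝ) / q| ≤ 1 / (8 * q * N)}

/-- The minor arcs `m_N = [0,1] \ M_N`. -/
def minorArcs (N : ℝ) : Set ℝ := Set.Icc (0 : ℝ) 1 \ majorArcs N

/-- The lattice box `ℤ^d ∩ [0,N]^d`. -/
def box (d : ℕ) (N : ℝ) : Finset (V d) :=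
  Fintype.piFinset fun _ => Finset.Icc (0 : ℤ) ⌊N⌋

/-- The minor-arc error operator
`E_{m,λ} f(x) = N(λ)⁻¹ ∫_{m_N} Σ_{u,v ∈ ℤ^d ∩ [0,N]^d} e(θ(|u|² + |v|² - λ)) f(x-u) dθ`. -/
def Eminor (d lam : ℕ) (N : ℝ) (f : V d → ℂ) (x : V d) : ℂ :=
  (Ncount d lam : ℂ)⁻¹ *
    ∫ θ in minorArcs N,
      ∑ u ∈ box d N, ∑ v ∈ box d N,
        eC (θ * (((∑ i, u i ^ 2) + (∑ i, v i ^ 2) - (lam : ℤ) : ℤ) : ℝ)) * f (x - u)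

/-- The `l^p(ℤ^d)` norm of a complex-valued function. -/
def lpNorm (d : ℕ) (p : ℝ) (f : V d → ℂ) : ℝ≥0∞ :=
  (∑' x : V d, (‖f x‖₊ : ℝ≥0∞) ^ p) ^ (1 / p)

/-- The `l^p(ℤ^d)` norm of an `ℝ≥0∞`-valued function. -/
def lpNormE (d : ℕ) (p : ℝ) (F : V d → ℝ≥0∞) : ℝ≥0∞ :=
  (∑' x : V d, F x ^ p) ^ (1 / p)

/-- The divisor sum `Σ_{k ∣ m} χ₄(k)`. -/
def chiFourDivisorSum (m : ℕ) : ℤ := ∑ k ∈ m.divisors, ZMod.χ₄ (k : ZMod 4)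

lemma chiFourDivisorSum_mul {m n : ℕ} (h : m.Coprime n) :
    chiFourDivisorSum (m * n) = chiFourDivisorSum m * chiFourDivisorSum n := by
  unfold chiFourDivisorSum
  rw [Finset.sum_mul_sum, ← Finset.sum_product', Nat.divisors_mul, ← Finset.image_mul_product,
    Finset.sum_image]
  · simp only [Nat.cast_mul, map_mul]
  · intro x hx y hy hxy
    exact h.mul_injOn_divisors hx hy hxy

lemma chiFourDivisorSum_prime_pow {p : ℕ} (hp : p.Prime) (e : ℕ) :
    chiFourDivisorSum (p ^ e) = ∑ i ∈ Finset.range (e + 1), ZMod.χ₄ (p : ZMod 4) ^ i := by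
  simp only [chiFourDivisorSum, Nat.sum_divisors_prime_pow hp, Nat.cast_pow, map_pow]

lemma GaussianInt.odd_re_even_im_mul {z w : GaussianInt} (hz : Odd z.re ∧ Even z.im)
    (hw : Odd w.re ∧ Even w.im) : Odd (z * w).re ∧ Even (z * w).im := by
  simp only [Zsqrtd.re_mul, Zsqrtd.im_mul]
  obtain ⟨h1, h2⟩ := hz
  obtain ⟨h3, h4⟩ := hw
  constructor
  · exact (h1.mul h3).add_even (h4.mul_left _)
  · exact (h4.mul_left _).add (h2.mul_right _)

lemma GaussianInt.odd_re_even_im_pow {z : GaussianInt} (hz : Odd z.re ∧ Even z.im) (k : ℕ) :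
    Odd (z ^ k).re ∧ Even (z ^ k).im := by
  induction k with
  | zero => simp
  | succ k ih => rw [pow_succ]; exact odd_re_even_im_mul ih hz

lemma GaussianInt.norm_pow (z : GaussianInt) (k : ℕ) : (z ^ k).norm = z.norm ^ k :=
  map_pow Zsqrtd.normMonoidHom z k

lemma Nat.Prime.exists_gaussianInt_norm_eq {p : ℕ} (hp : p.Prime) (hp4 : p % 4 = 1) :
    ∃ z : GaussianInt, z.norm = p ∧ Odd z.re ∧ Even z.im := by
  have := Fact.mk hp
  obtain ⟨a, b, hab⟩ := Nat.Prime.sq_add_sq (p := p) (by omega)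
  have hodd : Odd (a ^ 2 + b ^ 2) := by rw [hab, Nat.odd_iff]; omega
  rcases Nat.even_or_odd a with ha | ha
  · have hb : Odd b := by
      by_contra hb
      have := (ha.pow_of_ne_zero two_ne_zero).add
        ((Nat.not_odd_iff_even.1 hb).pow_of_ne_zero two_ne_zero)
      exact Nat.not_even_iff_odd.2 hodd this
    refine ⟨⟨b, a⟩, ?_, (Int.odd_coe_nat b).2 hb, (Int.even_coe_nat a).2 ha⟩
    rw [Zsqrtd.norm_def, ← hab]; push_cast; ring
  · have hb : Even b := by
      by_contra hb
      have := (ha.pow (n := 2)).add_odd ((Nat.not_even_iff_odd.1 hb).pow (n := 2))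
      exact Nat.not_even_iff_odd.2 hodd this
    refine ⟨⟨a, b⟩, ?_, (Int.odd_coe_nat a).2 ha, (Int.even_coe_nat b).2 hb⟩
    rw [Zsqrtd.norm_def, ← hab]; push_cast; ring

/-- A Gaussian integer of odd prime norm is coprime to its conjugate. -/
lemma GaussianInt.isCoprime_star {p : ℕ} (hp : p.Prime) (hp2 : p ≠ 2) {z : GaussianInt}
    (hz : z.norm = p) : IsCoprime z (star z) := by
  have hre : ¬ (p : ℤ) ∣ z.re := by
    intro h
    have hn : (p : ℤ) ∣ z.im * z.im := by
      have : z.im * z.im = p - z.re * z.re := by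
        have := Zsqrtd.norm_def z
        linarith
      rw [this]; exact dvd_sub dvd_rfl (h.mul_right _)
    have hp' := Nat.prime_iff_prime_int.1 hp
    have him' := (hp'.dvd_or_dvd hn).elim id id
    have : (p : ℤ) * p ∣ p := by
      have h2 : (p : ℤ) = z.re * z.re + z.im * z.im := by
        have := Zsqrtd.norm_def z
        linarith
      conv_rhs => rw [h2]
      exact dvd_add (mul_dvd_mul h h) (mul_dvd_mul him' him')
    have h3 := Int.le_of_dvd (by exact_mod_cast hp.pos) this
    have h4 : (2 : ℤ) ≤ p := by exact_mod_cast hp.two_le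
    nlinarith
  have hcop : IsCoprime (2 * z.re) (p : ℤ) := by
    apply IsCoprime.symm
    rw [(Nat.prime_iff_prime_int.1 hp).coprime_iff_not_dvd]
    intro h
    rcases (Nat.prime_iff_prime_int.1 hp).dvd_or_dvd h with h | h
    · have : p ∣ 2 := by exact_mod_cast h
      exact hp2 ((Nat.prime_dvd_prime_iff_eq hp Nat.prime_two).1 this)
    · exact hre h
  obtain ⟨x, y, hxy⟩ := hcop
  have hsum : ((2 * z.re : ℤ) : GaussianInt) = z + star z := by
    ext <;> simp; ring
  have hmul : ((p : ℤ) : GaussianInt) = z * star z := by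
    rw [← hz, Zsqrtd.norm_eq_mul_conj]
  have h := congrArg (Int.cast : ℤ → GaussianInt) hxy
  rw [Int.cast_add, Int.cast_mul, Int.cast_mul _ (p : ℤ), hsum, hmul] at h
  refine ⟨x + y * star z, x, ?_⟩
  rw [Int.cast_one] at h
  linear_combination h

lemma GaussianInt.isCoprime_of_isCoprime_norm {z w : GaussianInt}
    (h : IsCoprime z.norm w.norm) : IsCoprime z w := by
  have := h.map (Int.castRingHom GaussianInt)
  simp only [eq_intCast, Zsqrtd.norm_eq_mul_conj] at this
  exact this.of_mul_left_left.of_mul_right_left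

/-- Multiplying by `z ^ k * (star z) ^ (e - k)` separates distinct exponents `k` when `z` has
odd prime norm. -/
lemma GaussianInt.le_of_pow_mul_star_pow_eq {p : ℕ} (hp : p.Prime) (hp2 : p ≠ 2)
    {z : GaussianInt} (hz : z.norm = p) {m e k l : ℕ} (hm : ¬ p ∣ m)
    (hk : k ≤ e) {u w : GaussianInt} (hw : w.norm = m)
    (h : z ^ k * star z ^ (e - k) * u = z ^ l * star z ^ (e - l) * w) : k ≤ l := by
  by_contra! hlt
  have hz0 : z ≠ 0 := by
    rintro rfl
    simp only [Zsqrtd.norm_zero] at hz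
    exact hp.ne_zero (by exact_mod_cast hz.symm)
  have h' : z ^ (k - l) * u = star z ^ (k - l) * w := by
    have hne : z ^ l * star z ^ (e - k) ≠ 0 :=
      mul_ne_zero (pow_ne_zero _ hz0) (pow_ne_zero _ (star_ne_zero.2 hz0))
    apply mul_left_cancel₀ hne
    have h1 : z ^ k = z ^ l * z ^ (k - l) := by rw [← pow_add]; congr 1; omega
    have h2 : star z ^ (e - l) = star z ^ (e - k) * star z ^ (k - l) := by
      rw [← pow_add]; congr 1; omega
    rw [h1, h2] at h
    linear_combination h
  have hdvd : z ∣ star z ^ (k - l) * w := by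
    rw [← h']
    exact (dvd_pow_self z (by omega)).mul_right u
  have hcop : IsCoprime z (star z ^ (k - l) * w) := by
    refine IsCoprime.mul_right ((isCoprime_star hp hp2 hz).pow_right) ?_
    apply isCoprime_of_isCoprime_norm
    rw [hz, hw, Nat.isCoprime_iff_coprime]
    exact (hp.coprime_iff_not_dvd).2 hm
  have hu := hcop.isUnit_of_dvd' dvd_rfl hdvd
  rw [← Zsqrtd.norm_eq_one_iff, hz] at hu
  exact hp.one_lt.ne' (by simpa using hu)

/-- An odd `m` has at least `2 Σ_{k ∣ m} χ₄(k)` representations `m = x² + y²` with `x` odd and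
`y` even. -/
theorem exists_finset_gaussianInt_norm_eq (m : ℕ) (hm : Odd m) :
    ∃ s : Finset GaussianInt, 2 * chiFourDivisorSum m ≤ s.card ∧
      ∀ z ∈ s, z.norm = m ∧ Odd z.re ∧ Even z.im := by
  classical
  induction m using Nat.strong_induction_on with
  | _ m ih =>
  rcases eq_or_ne m 1 with rfl | hm1
  · refine ⟨{1, -1}, ?_, ?_⟩
    · rw [Finset.card_pair (by decide)]
      simp [chiFourDivisorSum]
    · intro z hz
      simp only [Finset.mem_insert, Finset.mem_singleton] at hz
      rcases hz with rfl | rfl <;> decide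
  have hm0 : m ≠ 0 := by rintro rfl; simp at hm
  set p := m.minFac with hpdef
  have hp : p.Prime := Nat.minFac_prime hm1
  have hpm : p ∣ m := m.minFac_dvd
  clear_value p
  obtain ⟨e, n, hn, rfl⟩ := Nat.exists_eq_pow_mul_and_not_dvd hm0 p hp.ne_one
  have hn0 : 0 < n := Nat.pos_of_ne_zero (by rintro rfl; simp at hn)
  have he : e ≠ 0 := by rintro rfl; simp at hpm; exact hn hpm
  have hpodd : Odd p := Odd.of_dvd_nat hm hpm
  have hp2 : p ≠ 2 := by rintro rfl; exact absurd hpodd (by decide)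
  have hnodd : Odd n := (Nat.odd_mul.1 hm).2
  have hlt : n < p ^ e * n := by
    have := Nat.one_lt_pow he hp.one_lt
    nlinarith
  obtain ⟨s, hs, hsn⟩ := ih n hlt hnodd
  have hg : chiFourDivisorSum (p ^ e * n) =
      (∑ i ∈ Finset.range (e + 1), ZMod.χ₄ (p : ZMod 4) ^ i) * chiFourDivisorSum n := by
    rw [chiFourDivisorSum_mul (Nat.Coprime.pow_left _ (hp.coprime_iff_not_dvd.2 hn)),
      chiFourDivisorSum_prime_pow hp]
  have hp4 : p % 4 = 1 ∨ p % 4 = 3 := by rw [Nat.odd_iff] at hpodd; omega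
  rcases hp4 with hp4 | hp4
  · obtain ⟨ϖ, hϖ, hϖo⟩ := hp.exists_gaussianInt_norm_eq hp4
    have hϖs : Odd (star ϖ).re ∧ Even (star ϖ).im := by simpa using hϖo
    have hϖ0 : ϖ ≠ 0 := by
      rintro rfl
      simp only [Zsqrtd.norm_zero] at hϖ
      exact hp.ne_zero (by exact_mod_cast hϖ.symm)
    refine ⟨(Finset.range (e + 1) ×ˢ s).image
      fun x => ϖ ^ x.1 * star ϖ ^ (e - x.1) * x.2, ?_, ?_⟩
    · rw [Finset.card_image_of_injOn, Finset.card_product, hg, ZMod.χ₄_nat_one_mod_four hp4]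
      · simp only [one_pow, Finset.sum_const, Finset.card_range, nsmul_eq_mul, mul_one]
        push_cast
        nlinarith
      · rintro ⟨k, u⟩ hku ⟨l, w⟩ hlw h
        simp only [Finset.coe_product, Set.mem_prod, Finset.mem_coe, Finset.mem_range] at hku hlw
        dsimp only at h
        have hkl : k = l := le_antisymm
          (GaussianInt.le_of_pow_mul_star_pow_eq hp hp2 hϖ hn (by omega)
            (hsn w hlw.2).1 h)
          (GaussianInt.le_of_pow_mul_star_pow_eq hp hp2 hϖ hn (by omega)
            (hsn u hku.2).1 h.symm)
        subst hkl
        have := mul_left_cancel₀ (mul_ne_zero (pow_ne_zero _ hϖ0)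
          (pow_ne_zero _ (star_ne_zero.2 hϖ0))) h
        rw [this]
    · intro z hz
      simp only [Finset.mem_image, Finset.mem_product, Finset.mem_range] at hz
      obtain ⟨⟨k, u⟩, ⟨hk, hu⟩, rfl⟩ := hz
      refine ⟨?_, GaussianInt.odd_re_even_im_mul (GaussianInt.odd_re_even_im_mul
        (GaussianInt.odd_re_even_im_pow hϖo _) (GaussianInt.odd_re_even_im_pow hϖs _)) (hsn u hu).2⟩
      rw [Zsqrtd.norm_mul, Zsqrtd.norm_mul, GaussianInt.norm_pow, GaussianInt.norm_pow,
        Zsqrtd.norm_conj, hϖ, (hsn u hu).1, ← pow_add]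
      dsimp only at hk ⊢
      rw [Nat.add_sub_cancel' (by omega)]
      push_cast; rfl
  · rw [ZMod.χ₄_nat_three_mod_four hp4, neg_one_geom_sum] at hg
    split_ifs at hg with heven
    · exact ⟨∅, by simp [hg], by simp⟩
    · obtain ⟨k, rfl⟩ : Even e := by
        rw [Nat.even_add_one, not_not] at heven; exact heven
      have hinj : Function.Injective fun z : GaussianInt => ((p : GaussianInt) ^ k) * z :=
        mul_right_injective₀ (pow_ne_zero _ (by exact_mod_cast hp.ne_zero))
      refine ⟨s.image fun z => (p : GaussianInt) ^ k * z, ?_, ?_⟩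
      · rw [Finset.card_image_of_injective _ hinj, hg, one_mul]; exact hs
      · intro z hz
        obtain ⟨u, hu, rfl⟩ := Finset.mem_image.1 hz
        refine ⟨?_, GaussianInt.odd_re_even_im_mul (GaussianInt.odd_re_even_im_pow ?_ _)
          (hsn u hu).2⟩
        · rw [Zsqrtd.norm_mul, GaussianInt.norm_pow, Zsqrtd.norm_natCast, (hsn u hu).1]
          push_cast; ring
        · simpa using hpodd

/-- The solutions of `a b + c e = 2u` in positive odd integers, as quadruples `(a, b, c, e)`. -/
def oddProductPairs (u : ℕ) : Finset (ℤ × ℤ × ℤ × ℤ) :=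
  (Finset.Icc (1 : ℤ) (2 * u) ×ˢ Finset.Icc (1 : ℤ) (2 * u) ×ˢ
    Finset.Icc (1 : ℤ) (2 * u) ×ˢ Finset.Icc (1 : ℤ) (2 * u)).filter fun x =>
    Odd x.1 ∧ Odd x.2.1 ∧ Odd x.2.2.1 ∧ Odd x.2.2.2 ∧ x.1 * x.2.1 + x.2.2.1 * x.2.2.2 = 2 * u

lemma mem_oddProductPairs {u : ℕ} {a b c e : ℤ} :
    (a, b, c, e) ∈ oddProductPairs u ↔ (0 < a ∧ 0 < b ∧ 0 < c ∧ 0 < e) ∧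
      (Odd a ∧ Odd b ∧ Odd c ∧ Odd e) ∧ a * b + c * e = 2 * u := by
  simp only [oddProductPairs, Finset.mem_filter, Finset.mem_product, Finset.mem_Icc]
  constructor
  · rintro ⟨⟨h1, h2, h3, h4⟩, h5, h6, h7, h8, h9⟩
    exact ⟨⟨by omega, by omega, by omega, by omega⟩, ⟨h5, h6, h7, h8⟩, h9⟩
  · rintro ⟨⟨h1, h2, h3, h4⟩, ⟨h5, h6, h7, h8⟩, h9⟩
    refine ⟨⟨⟨h1, ?_⟩, ⟨h2, ?_⟩, ⟨h3, ?_⟩, ⟨h4, ?_⟩⟩, h5, h6, h7, h8, h9⟩ <;> nlinarith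

lemma sum_chiFourDivisorSum_mul_eq (u : ℕ) :
    ∑ q ∈ (Finset.HasAntidiagonal.antidiagonal (2 * u)).filter (fun q => Odd q.1),
      chiFourDivisorSum q.1 * chiFourDivisorSum q.2 =
    ∑ x ∈ oddProductPairs u, ZMod.χ₄ (x.1 : ZMod 4) * ZMod.χ₄ (x.2.2.1 : ZMod 4) := by
  have h : ∀ q : ℕ × ℕ, chiFourDivisorSum q.1 * chiFourDivisorSum q.2 =
      ∑ p ∈ q.1.divisorsAntidiagonal ×ˢ q.2.divisorsAntidiagonal,
        ZMod.χ₄ (p.1.1 : ZMod 4) * ZMod.χ₄ (p.2.1 : ZMod 4) := by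
    intro q
    rw [Finset.sum_product]
    dsimp only
    rw [← Finset.sum_mul_sum, Nat.sum_divisorsAntidiagonal fun k _ => ZMod.χ₄ (k : ZMod 4),
      Nat.sum_divisorsAntidiagonal fun k _ => ZMod.χ₄ (k : ZMod 4)]
    rfl
  simp only [h]
  rw [Finset.sum_sigma']
  refine Finset.sum_nbij
    (fun x => ((x.2.1.1 : ℤ), (x.2.1.2 : ℤ), (x.2.2.1 : ℤ), (x.2.2.2 : ℤ))) ?_ ?_ ?_ ?_
  · rintro ⟨⟨m, n⟩, ⟨⟨a, b⟩, ⟨c, e⟩⟩⟩ hx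
    simp only [Finset.mem_sigma, Finset.mem_filter, Finset.HasAntidiagonal.mem_antidiagonal, Finset.mem_product,
      Nat.mem_divisorsAntidiagonal] at hx
    obtain ⟨⟨hmn, hm⟩, ⟨rfl, h1⟩, rfl, h2⟩ := hx
    have hn : Odd (c * e) := by
      rw [Nat.odd_iff] at hm ⊢
      omega
    obtain ⟨ha, hb⟩ := Nat.odd_mul.1 hm
    obtain ⟨hc, he⟩ := Nat.odd_mul.1 hn
    rw [mem_oddProductPairs]
    refine ⟨⟨by exact_mod_cast ha.pos, by exact_mod_cast hb.pos, by exact_mod_cast hc.pos,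
      by exact_mod_cast he.pos⟩, ⟨by exact_mod_cast ha, by exact_mod_cast hb, by exact_mod_cast hc,
      by exact_mod_cast he⟩, by exact_mod_cast hmn⟩
  · rintro ⟨⟨m, n⟩, ⟨⟨a, b⟩, ⟨c, e⟩⟩⟩ hx ⟨⟨m', n'⟩, ⟨⟨a', b'⟩, ⟨c', e'⟩⟩⟩ hx' hxx
    simp only [Finset.mem_coe, Finset.mem_sigma, Finset.mem_filter, Finset.HasAntidiagonal.mem_antidiagonal,
      Finset.mem_product, Nat.mem_divisorsAntidiagonal] at hx hx'
    obtain ⟨-, ⟨rfl, -⟩, rfl, -⟩ := hx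
    obtain ⟨-, ⟨rfl, -⟩, rfl, -⟩ := hx'
    simp only [Prod.mk.injEq, Nat.cast_inj] at hxx
    obtain ⟨rfl, rfl, rfl, rfl⟩ := hxx
    rfl
  · rintro ⟨a, b, c, e⟩ hx
    obtain ⟨⟨h1, h2, h3, h4⟩, ⟨h5, h6, h7, h8⟩, h9⟩ := mem_oddProductPairs.1 hx
    lift a to ℕ using h1.le
    lift b to ℕ using h2.le
    lift c to ℕ using h3.le
    lift e to ℕ using h4.le
    refine ⟨⟨(a * b, c * e), ((a, b), (c, e))⟩, ?_, rfl⟩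
    norm_cast at h1 h2 h3 h4 h5 h6 h9
    simp only [Finset.mem_coe, Finset.mem_sigma, Finset.mem_filter, Finset.HasAntidiagonal.mem_antidiagonal,
      Finset.mem_product, Nat.mem_divisorsAntidiagonal]
    exact ⟨⟨h9, h5.mul h6⟩, ⟨trivial, (Nat.mul_pos h1 h2).ne'⟩, trivial, (Nat.mul_pos h3 h4).ne'⟩
  · rintro ⟨⟨m, n⟩, ⟨⟨a, b⟩, ⟨c, e⟩⟩⟩ -
    simp

/-- Dirichlet's involution on the solutions of `a b + c e = 2u` with `c < a`. -/
def dirichletInvolution (x : ℤ × ℤ × ℤ × ℤ) : ℤ × ℤ × ℤ × ℤ :=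
  let t := x.2.2.1 / (x.1 - x.2.2.1)
  ((t + 2) * x.2.1 + (t + 1) * x.2.2.2, -t * x.1 + (t + 1) * x.2.2.1,
    (t + 1) * x.2.1 + t * x.2.2.2, (t + 1) * x.1 - (t + 2) * x.2.2.1)

lemma chiFour_mul_add_chiFour_mul_eq_zero {u : ℕ} (hu : Odd u) {a b c e : ℤ} (t : ℤ)
    (ha : Odd a) (hb : Odd b) (hc : Odd c) (he : Odd e) (h : a * b + c * e = 2 * u) :
    ZMod.χ₄ (a : ZMod 4) * ZMod.χ₄ (c : ZMod 4) +
      ZMod.χ₄ (((t + 2) * b + (t + 1) * e : ℤ) : ZMod 4) *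
        ZMod.χ₄ (((t + 1) * b + t * e : ℤ) : ZMod 4) = 0 := by
  have key : ∀ x : ℤ, Odd x → (x : ZMod 4) = 1 ∨ (x : ZMod 4) = 3 := by
    intro x hx
    have : x % 4 = 1 ∨ x % 4 = 3 := by
      rw [Int.odd_iff] at hx; omega
    rcases this with h | h
    · left; rw [← ZMod.intCast_mod x 4]; simp [h]
    · right; rw [← ZMod.intCast_mod x 4]; simp [h]
  have h2 : ((2 * u : ℤ) : ZMod 4) = 2 := by
    rcases key u (by exact_mod_cast hu) with h | h <;> push_cast at h ⊢ <;> rw [h] <;> decide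
  have h' := congrArg (Int.cast : ℤ → ZMod 4) h
  rw [h2] at h'
  push_cast at h' ⊢
  generalize (t : ZMod 4) = t at *
  revert t
  rcases key a ha with h1 | h1 <;> rcases key b hb with h3 | h3 <;>
    rcases key c hc with h4 | h4 <;> rcases key e he with h5 | h5 <;>
    rw [h1, h3, h4, h5] at h' <;> rw [h1, h3, h4, h5] <;> first | decide | (revert h'; decide)

lemma dirichletInvolution_spec {u : ℕ} {x : ℤ × ℤ × ℤ × ℤ}
    (hx : x ∈ (oddProductPairs u).filter fun x => x.2.2.1 < x.1) :
    dirichletInvolution x ∈ (oddProductPairs u).filter (fun x => x.2.2.1 < x.1) ∧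
      dirichletInvolution (dirichletInvolution x) = x := by
  obtain ⟨a, b, c, e⟩ := x
  rw [Finset.mem_filter, mem_oddProductPairs] at hx
  obtain ⟨⟨⟨h1, h2, h3, h4⟩, ⟨h5, h6, h7, h8⟩, h9⟩, hlt⟩ := hx
  dsimp only at hlt
  have hpos : 0 < a - c := by omega
  obtain ⟨t, ht⟩ : ∃ t, t = c / (a - c) := ⟨_, rfl⟩
  have ht0 : 0 ≤ t := ht ▸ Int.ediv_nonneg h3.le hpos.le
  have hle : t * (a - c) ≤ c := ht ▸ Int.ediv_mul_le c hpos.ne'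
  have hlt' : c < (t + 1) * (a - c) := ht ▸ Int.lt_ediv_add_one_mul_self c hpos
  have hne : t * (a - c) ≠ c := by
    intro h
    rw [← h] at h7
    exact Int.not_even_iff_odd.2 h7 ((h5.sub_odd (h ▸ h7)).mul_left t)
  have hval : dirichletInvolution (a, b, c, e) =
      ((t + 2) * b + (t + 1) * e, -t * a + (t + 1) * c, (t + 1) * b + t * e,
        (t + 1) * a - (t + 2) * c) := by
    simp only [dirichletInvolution, ht]
  have ht' : ((t + 1) * b + t * e) / ((t + 2) * b + (t + 1) * e - ((t + 1) * b + t * e)) = t := by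
    have : (t + 2) * b + (t + 1) * e - ((t + 1) * b + t * e) = b + e := by ring
    rw [this, Int.ediv_eq_iff_of_pos (by omega)]
    constructor <;> nlinarith
  rw [hval]
  constructor
  · rw [Finset.mem_filter, mem_oddProductPairs]
    refine ⟨⟨⟨by positivity, ?_, by positivity, by linarith⟩, ?_, ?_⟩, ?_⟩
    · have := lt_of_le_of_ne hle hne
      linarith
    · by_cases h : Odd t <;>
        simp [Int.odd_add, Int.odd_sub, Int.odd_mul, ← Int.not_odd_iff_even, h5, h6, h7, h8, h]
    · linear_combination h9
    · dsimp only
      linarith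
  · simp only [dirichletInvolution, ht', Prod.mk.injEq]
    refine ⟨by ring, by ring, by ring, by ring⟩

lemma sum_oddProductPairs_filter_lt {u : ℕ} (hu : Odd u) :
    ∑ x ∈ (oddProductPairs u).filter (fun x => x.2.2.1 < x.1),
      ZMod.χ₄ (x.1 : ZMod 4) * ZMod.χ₄ (x.2.2.1 : ZMod 4) = 0 := by
  have hsum : ∀ x ∈ (oddProductPairs u).filter (fun x => x.2.2.1 < x.1),
      ZMod.χ₄ (x.1 : ZMod 4) * ZMod.χ₄ (x.2.2.1 : ZMod 4) +
      ZMod.χ₄ ((dirichletInvolution x).1 : ZMod 4) *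
        ZMod.χ₄ ((dirichletInvolution x).2.2.1 : ZMod 4) = 0 := by
    rintro ⟨a, b, c, e⟩ hx
    obtain ⟨-, ⟨h5, h6, h7, h8⟩, h9⟩ := mem_oddProductPairs.1 (Finset.mem_filter.1 hx).1
    exact chiFour_mul_add_chiFour_mul_eq_zero hu _ h5 h6 h7 h8 h9
  refine Finset.sum_involution (fun x _ => dirichletInvolution x) hsum ?_
    (fun x hx => (dirichletInvolution_spec hx).1) (fun x hx => (dirichletInvolution_spec hx).2)
  intro x hx h0 heq
  have := hsum x hx
  rw [heq] at this
  omega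

lemma le_sum_oddProductPairs {u : ℕ} (hu : Odd u) :
    (u : ℤ) ≤ ∑ x ∈ oddProductPairs u, ZMod.χ₄ (x.1 : ZMod 4) * ZMod.χ₄ (x.2.2.1 : ZMod 4) := by
  have hgt : ∑ x ∈ (oddProductPairs u).filter (fun x => x.1 < x.2.2.1),
      ZMod.χ₄ (x.1 : ZMod 4) * ZMod.χ₄ (x.2.2.1 : ZMod 4) = 0 := by
    rw [← sum_oddProductPairs_filter_lt hu]
    have hmem : ∀ a b c e : ℤ, (a, b, c, e) ∈ oddProductPairs u →
        (c, e, a, b) ∈ oddProductPairs u := by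
      intro a b c e h
      rw [mem_oddProductPairs] at h ⊢
      obtain ⟨⟨h1, h2, h3, h4⟩, ⟨h5, h6, h7, h8⟩, h9⟩ := h
      exact ⟨⟨h3, h4, h1, h2⟩, ⟨h7, h8, h5, h6⟩, by linarith⟩
    refine Finset.sum_nbij' (fun x => (x.2.2.1, x.2.2.2, x.1, x.2.1))
      (fun x => (x.2.2.1, x.2.2.2, x.1, x.2.1)) ?_ ?_ (fun _ _ => rfl) (fun _ _ => rfl)
      (fun _ _ => mul_comm _ _)
    all_goals
      rintro ⟨a, b, c, e⟩ h
      rw [Finset.mem_filter] at h ⊢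
      exact ⟨hmem _ _ _ _ h.1, h.2⟩
  rw [← Finset.sum_filter_add_sum_filter_not _ (fun x => x.2.2.1 < x.1),
    sum_oddProductPairs_filter_lt hu, zero_add,
    ← Finset.sum_filter_add_sum_filter_not _ (fun x => x.1 < x.2.2.1), Finset.filter_filter]
  have hfil : (oddProductPairs u).filter (fun x => ¬ x.2.2.1 < x.1 ∧ x.1 < x.2.2.1) =
      (oddProductPairs u).filter (fun x => x.1 < x.2.2.1) :=
    Finset.filter_congr fun x _ => ⟨fun h => h.2, fun h => ⟨h.not_gt, h⟩⟩
  rw [hfil, hgt, zero_add, Finset.filter_filter]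
  have hone : ∀ x ∈ (oddProductPairs u).filter (fun x => ¬ x.2.2.1 < x.1 ∧ ¬ x.1 < x.2.2.1),
      ZMod.χ₄ (x.1 : ZMod 4) * ZMod.χ₄ (x.2.2.1 : ZMod 4) = 1 := by
    rintro ⟨a, b, c, e⟩ hx
    rw [Finset.mem_filter, mem_oddProductPairs] at hx
    obtain ⟨⟨-, ⟨h5, -⟩, -⟩, h1, h2⟩ := hx
    dsimp only at h1 h2 ⊢
    obtain rfl : a = c := by omega
    have : a % 4 = 1 ∨ a % 4 = 3 := by
      rw [Int.odd_iff] at h5; omega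
    rcases this with h | h
    · rw [ZMod.χ₄_int_one_mod_four h]; rfl
    · rw [ZMod.χ₄_int_three_mod_four h]; rfl
  rw [Finset.sum_congr rfl hone]
  simp only [Finset.sum_const, nsmul_eq_mul, mul_one, Nat.cast_le]
  have hinj : Function.Injective
      (fun i : ℕ => ((1 : ℤ), (2 * i + 1 : ℤ), (1 : ℤ), (2 * u - 1 - 2 * i : ℤ))) := by
    intro i j h
    simp only [Prod.mk.injEq] at h
    omega
  refine (Finset.card_range u ▸ Finset.card_image_of_injective (Finset.range u) hinj).ge.trans
    (Finset.card_le_card fun x hx => ?_)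
  obtain ⟨i, hi, rfl⟩ := Finset.mem_image.1 hx
  rw [Finset.mem_range] at hi
  rw [Finset.mem_filter, mem_oddProductPairs]
  refine ⟨⟨⟨by omega, by omega, by omega, by omega⟩, ⟨odd_one, ⟨i, by ring⟩, odd_one,
    ⟨u - 1 - i, by ring⟩⟩, by ring⟩, by simp, by simp⟩

lemma chiFourDivisorSum_nonneg (m : ℕ) : 0 ≤ chiFourDivisorSum m := by
  induction m using Nat.recOnPrimeCoprime with
  | zero => simp [chiFourDivisorSum]
  | prime_pow p k hp =>
    rw [chiFourDivisorSum_prime_pow hp]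
    rcases ZMod.isQuadratic_χ₄ (p : ZMod 4) with h | h | h
    · rw [h]; exact Finset.sum_nonneg fun i _ => pow_nonneg le_rfl i
    · rw [h]; exact Finset.sum_nonneg fun i _ => pow_nonneg zero_le_one i
    · rw [h, neg_one_geom_sum]; split_ifs <;> norm_num
  | coprime a b _ _ hab iha ihb =>
    rw [chiFourDivisorSum_mul hab]; exact mul_nonneg iha ihb

/-- An odd `u` has at least `4u` representations as a sum of four integer squares. -/
theorem exists_finset_sum_four_squares {u : ℕ} (hu : Odd u) :
    ∃ s : Finset (ℤ × ℤ × ℤ × ℤ), 4 * u ≤ s.card ∧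
      ∀ x ∈ s, x.1 ^ 2 + x.2.1 ^ 2 + x.2.2.1 ^ 2 + x.2.2.2 ^ 2 = u := by
  classical
  choose! S hS using exists_finset_gaussianInt_norm_eq
  set A := (Finset.HasAntidiagonal.antidiagonal (2 * u)).filter (fun q => Odd q.1) with hA
  have hA' : ∀ q ∈ A, Odd q.1 ∧ Odd q.2 ∧ q.1 + q.2 = 2 * u := by
    intro q hq
    rw [hA, Finset.mem_filter, Finset.HasAntidiagonal.mem_antidiagonal] at hq
    refine ⟨hq.2, ?_, hq.1⟩
    have h1 := hq.1
    have h2 := hq.2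
    rw [Nat.odd_iff] at h2 ⊢
    omega
  set P := A.biUnion (fun q => S q.1 ×ˢ S q.2) with hP
  have hPmem : ∀ x ∈ P, (Odd x.1.re ∧ Even x.1.im) ∧ (Odd x.2.re ∧ Even x.2.im) ∧
      x.1.norm + x.2.norm = 2 * u := by
    intro x hx
    obtain ⟨q, hq, hxq⟩ := Finset.mem_biUnion.1 hx
    obtain ⟨hx1, hx2⟩ := Finset.mem_product.1 hxq
    obtain ⟨h1, h2, h3⟩ := hA' q hq
    have h4 := (hS _ h1).2 _ hx1
    have h5 := (hS _ h2).2 _ hx2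
    refine ⟨h4.2, h5.2, ?_⟩
    rw [h4.1, h5.1]
    exact_mod_cast h3
  have hdisj : Set.PairwiseDisjoint (A : Set (ℕ × ℕ)) (fun q => S q.1 ×ˢ S q.2) := by
    intro q hq r hr hqr
    rw [Function.onFun, Finset.disjoint_left]
    intro x hxq hxr
    obtain ⟨hq1, hq2⟩ := Finset.mem_product.1 hxq
    obtain ⟨hr1, hr2⟩ := Finset.mem_product.1 hxr
    obtain ⟨h1, h2, -⟩ := hA' q hq
    obtain ⟨h3, h4, -⟩ := hA' r hr
    refine hqr (Prod.ext ?_ ?_)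
    · have := ((hS _ h1).2 _ hq1).1.symm.trans ((hS _ h3).2 _ hr1).1
      exact_mod_cast this
    · have := ((hS _ h2).2 _ hq2).1.symm.trans ((hS _ h4).2 _ hr2).1
      exact_mod_cast this
  have hcard : (4 * u : ℤ) ≤ P.card := by
    rw [hP, Finset.card_biUnion hdisj]
    have h1 := (le_sum_oddProductPairs hu).trans_eq (sum_chiFourDivisorSum_mul_eq u).symm
    calc (4 * u : ℤ) ≤ 4 * ∑ q ∈ A, chiFourDivisorSum q.1 * chiFourDivisorSum q.2 := by linarith
      _ = ∑ q ∈ A, (2 * chiFourDivisorSum q.1) * (2 * chiFourDivisorSum q.2) := by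
        rw [Finset.mul_sum]
        exact Finset.sum_congr rfl fun q _ => by ring
      _ ≤ ∑ q ∈ A, ((S q.1).card : ℤ) * ((S q.2).card : ℤ) := by
        refine Finset.sum_le_sum fun q hq => ?_
        obtain ⟨h1, h2, -⟩ := hA' q hq
        exact mul_le_mul (hS _ h1).1 (hS _ h2).1
          (mul_nonneg zero_le_two (chiFourDivisorSum_nonneg _)) (by positivity)
      _ = _ := by
        push_cast [Finset.card_product]
        rfl
  refine ⟨P.image fun x => ((x.1.re + x.2.re) / 2, (x.1.re - x.2.re) / 2,
    (x.1.im + x.2.im) / 2, (x.1.im - x.2.im) / 2), ?_, ?_⟩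
  · rw [Finset.card_image_of_injOn]
    · exact_mod_cast hcard
    · rintro ⟨⟨a, b⟩, ⟨c, e⟩⟩ hx ⟨⟨a', b'⟩, ⟨c', e'⟩⟩ hx' h
      obtain ⟨⟨⟨a, rfl⟩, ⟨b, rfl⟩⟩, ⟨⟨c, rfl⟩, ⟨e, rfl⟩⟩, -⟩ := hPmem _ hx
      obtain ⟨⟨⟨a', rfl⟩, ⟨b', rfl⟩⟩, ⟨⟨c', rfl⟩, ⟨e', rfl⟩⟩, -⟩ := hPmem _ hx'
      simp only [Prod.mk.injEq, Zsqrtd.mk.injEq] at h ⊢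
      omega
  · intro y hy
    obtain ⟨⟨⟨a, b⟩, ⟨c, e⟩⟩, hx, rfl⟩ := Finset.mem_image.1 hy
    obtain ⟨⟨⟨a, rfl⟩, ⟨b, rfl⟩⟩, ⟨⟨c, rfl⟩, ⟨e, rfl⟩⟩, h⟩ := hPmem _ hx
    simp only [Zsqrtd.norm_def] at h
    have h1 : (2 * a + 1 + (2 * c + 1)) / 2 = a + c + 1 := by omega
    have h2 : (2 * a + 1 - (2 * c + 1)) / 2 = a - c := by omega
    have h3 : (b + b + (e + e)) / 2 = b + e := by omega
    have h4 : (b + b - (e + e)) / 2 = b - e := by omega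
    simp only [h1, h2, h3, h4]
    apply mul_left_cancel₀ (two_ne_zero (α := ℤ))
    linear_combination h

lemma finite_sph (d n : ℕ) : (sph d n).Finite := by
  have hfin := Set.finite_Icc (fun _ => -(n : ℤ) : V d) fun _ => (n : ℤ)
  refine (hfin.prod hfin).subset ?_
  rintro ⟨u, v⟩ h
  simp only [sph, Set.mem_ofPred_eq] at h
  have hu0 : 0 ≤ ∑ i, u i ^ 2 := Finset.sum_nonneg fun i _ => sq_nonneg _
  have hv0 : 0 ≤ ∑ i, v i ^ 2 := Finset.sum_nonneg fun i _ => sq_nonneg _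
  have key : ∀ w : V d, ∑ i, w i ^ 2 ≤ n → ∀ i, -(n : ℤ) ≤ w i ∧ w i ≤ n := by
    intro w hw i
    have := (Finset.single_le_sum (f := fun i => w i ^ 2) (fun i _ => sq_nonneg _)
      (Finset.mem_univ i)).trans hw
    constructor <;> nlinarith
  exact ⟨⟨fun i => (key u (by linarith) i).1, fun i => (key u (by linarith) i).2⟩,
    ⟨fun i => (key v (by linarith) i).1, fun i => (key v (by linarith) i).2⟩⟩

lemma card_le_Ncount {d n : ℕ} (s : Finset (V d × V d)) (hs : ∀ x ∈ s, x ∈ sph d n) :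
    s.card ≤ Ncount d n := by
  rw [Ncount, Nat.card_coe_set_eq, ← Set.ncard_coe_finset]
  exact Set.ncard_le_ncard hs (finite_sph d n)

/-- Completing vectors of small total square sum by four squares: if each of finitely many pairs
`(y, z)` leaves an odd remainder at least `n / 2`, there are at least `2n` points of the sphere
over each pair. -/
lemma card_mul_le_Ncount {e n : ℕ} (I : Finset (V e × V e)) (W : V e × V e → ℕ)
    (hW : ∀ p ∈ I, ∑ i, p.1 i ^ 2 + ∑ i, p.2 i ^ 2 = (W p : ℤ))
    (hle : ∀ p ∈ I, 2 * W p ≤ n) (hodd : ∀ p ∈ I, Odd (n - W p)) :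
    I.card * (2 * n) ≤ Ncount (e + 2) n := by
  classical
  have hex : ∀ u : ℕ, Odd u → ∃ s : Finset (ℤ × ℤ × ℤ × ℤ), 4 * u ≤ s.card ∧
      ∀ x ∈ s, x.1 ^ 2 + x.2.1 ^ 2 + x.2.2.1 ^ 2 + x.2.2.2 ^ 2 = u :=
    fun u hu => exists_finset_sum_four_squares hu
  choose! R hRcard hR using hex
  let F : (Σ _ : V e × V e, ℤ × ℤ × ℤ × ℤ) → V (e + 2) × V (e + 2) := fun x =>
    (Fin.cons x.2.1 (Fin.cons x.2.2.1 x.1.1 : V (e + 1)),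
      Fin.cons x.2.2.2.1 (Fin.cons x.2.2.2.2 x.1.2 : V (e + 1)))
  have hF : Function.Injective F := by
    rintro ⟨⟨y, z⟩, a, b, c, k⟩ ⟨⟨y', z'⟩, a', b', c', k'⟩ h
    simp only [F, Prod.mk.injEq, Fin.cons_inj] at h
    obtain ⟨⟨rfl, rfl, rfl⟩, rfl, rfl, rfl⟩ := h
    rfl
  calc I.card * (2 * n) = ∑ p ∈ I, 2 * n := by rw [Finset.sum_const, smul_eq_mul]
    _ ≤ ∑ p ∈ I, (R (n - W p)).card := by
      refine Finset.sum_le_sum fun p hp => le_trans ?_ (hRcard _ (hodd p hp))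
      have := hle p hp
      omega
    _ = ((I.sigma fun p => R (n - W p)).image F).card := by
      rw [Finset.card_image_of_injective _ hF, Finset.card_sigma]
    _ ≤ Ncount (e + 2) n := by
      refine card_le_Ncount _ fun x hx => ?_
      obtain ⟨⟨⟨y, z⟩, a, b, c, k⟩, hmem, rfl⟩ := Finset.mem_image.1 hx
      obtain ⟨hp, hq⟩ := Finset.mem_sigma.1 hmem
      have h1 := hR _ (hodd _ hp) _ hq
      have h2 := hW _ hp
      have h3 := hle _ hp
      rw [Nat.cast_sub (by omega)] at h1
      simp only [F, sph, Set.mem_ofPred_eq, Fin.sum_univ_succ, Fin.cons_zero, Fin.cons_succ]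
      simp only at h1 h2
      linarith

/-- `N(n) ≳ n ^ (d - 1)` for `d = e + 2 ≥ 3`. -/
theorem pow_le_mul_Ncount {e n : ℕ} (he : 0 < e) (hn : 0 < n) :
    n ^ (e + 1) ≤ (36 * e) ^ e * Ncount (e + 2) n := by
  classical
  set T := Nat.sqrt (n / (36 * e)) with hT
  have hTle : 36 * e * T ^ 2 ≤ n := by
    have := Nat.sqrt_le' (n / (36 * e))
    exact (Nat.mul_le_mul_left _ this).trans (Nat.mul_div_le n _)
  have hTlt : n < 36 * e * (T + 1) ^ 2 := by
    have := Nat.lt_succ_sqrt' (n / (36 * e))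
    rw [Nat.div_lt_iff_lt_mul (by positivity)] at this
    rw [mul_comm]; exact this
  obtain ⟨ε, hε⟩ : ∃ ε, ε = (n + 1) % 2 := ⟨_, rfl⟩
  let δ : Fin e → ℕ := fun i => if i = ⟨0, he⟩ then ε else 0
  have hδsum : ∑ i, δ i = ε := by simp [δ]
  have hδ : ∀ i, δ i = 0 ∨ δ i = 1 := by
    intro i
    by_cases h : i = ⟨0, he⟩
    · have : δ i = ε := if_pos h
      omega
    · exact Or.inl (if_neg h)
  let Q : Finset (Fin e → ℕ) := Fintype.piFinset fun _ => Finset.range (T + 1)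
  let G : (Fin e → ℕ) × (Fin e → ℕ) → V e × V e := fun p =>
    (fun i => ((2 * p.1 i + δ i : ℕ) : ℤ), fun i => ((2 * p.2 i : ℕ) : ℤ))
  have hG : Function.Injective G := by
    rintro ⟨s, t⟩ ⟨s', t'⟩ h
    simp only [G, Prod.mk.injEq, funext_iff] at h ⊢
    exact ⟨fun i => by have := h.1 i; omega, fun i => by have := h.2 i; omega⟩
  let W : V e × V e → ℕ := fun p => ∑ i, (p.1 i).natAbs ^ 2 + ∑ i, (p.2 i).natAbs ^ 2
  have hWG : ∀ p, W (G p) = ∑ i, (2 * p.1 i + δ i) ^ 2 + ∑ i, (2 * p.2 i) ^ 2 := fun p => by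
    simp only [W, G, Int.natAbs_natCast]
  have hQ : ∀ p ∈ Q ×ˢ Q, ∀ i, p.1 i ≤ T ∧ p.2 i ≤ T := by
    intro p hp i
    simp only [Q, Finset.mem_product, Fintype.mem_piFinset, Finset.mem_range] at hp
    exact ⟨Nat.lt_succ_iff.1 (hp.1 i), Nat.lt_succ_iff.1 (hp.2 i)⟩
  have hWle : ∀ q ∈ Q ×ˢ Q, 2 * W (G q) ≤ n := by
    intro q hq
    rw [hWG]
    rcases Nat.eq_zero_or_pos T with h0 | hpos
    · have h1 : ∀ i, (2 * q.1 i + δ i) ^ 2 = δ i := by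
        intro i
        have := (hQ q hq i).1
        rw [show q.1 i = 0 by omega]
        rcases hδ i with h | h <;> rw [h] <;> rfl
      have h2 : ∀ i, (2 * q.2 i) ^ 2 = 0 := by
        intro i
        have := (hQ q hq i).2
        rw [show q.2 i = 0 by omega]; rfl
      simp only [h1, h2, hδsum, Finset.sum_const_zero]
      omega
    · have h1 : ∑ i, (2 * q.1 i + δ i) ^ 2 ≤ e * (3 * T) ^ 2 := by
        refine (Finset.sum_le_card_nsmul _ _ ((3 * T) ^ 2) fun i _ => ?_).trans_eq (by simp)
        refine Nat.pow_le_pow_left ?_ 2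
        have := (hQ q hq i).1
        have := hδ i
        omega
      have h2 : ∑ i, (2 * q.2 i) ^ 2 ≤ e * (3 * T) ^ 2 := by
        refine (Finset.sum_le_card_nsmul _ _ ((3 * T) ^ 2) fun i _ => ?_).trans_eq (by simp)
        refine Nat.pow_le_pow_left ?_ 2
        have := (hQ q hq i).2
        omega
      linarith
  have hcard := card_mul_le_Ncount (n := n) ((Q ×ˢ Q).image G) W ?_ ?_ ?_
  · rw [Finset.card_image_of_injective _ hG, Finset.card_product, Fintype.card_piFinset_const,
      Finset.card_range] at hcard
    calc n ^ (e + 1) = n ^ e * n := pow_succ _ _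
      _ ≤ (36 * e * (T + 1) ^ 2) ^ e * (2 * n) :=
        Nat.mul_le_mul (Nat.pow_le_pow_left hTlt.le e) (by omega)
      _ = (36 * e) ^ e * ((T + 1) ^ e * (T + 1) ^ e * (2 * n)) := by
        rw [mul_pow, ← pow_mul]; ring
      _ ≤ _ := Nat.mul_le_mul_left _ hcard
  · intro p _
    simp only [W]
    push_cast
    simp only [sq_abs]
  · intro p hp
    obtain ⟨q, hq, rfl⟩ := Finset.mem_image.1 hp
    exact hWle q hq
  · intro p hp
    obtain ⟨q, hq, rfl⟩ := Finset.mem_image.1 hp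
    have h1 : ∀ i, (2 * q.1 i + δ i) ^ 2 = 2 * (2 * q.1 i ^ 2 + 2 * q.1 i * δ i) + δ i := by
      intro i
      rcases hδ i with h | h <;> rw [h] <;> ring
    have h2 : W (G q) % 2 = ε % 2 := by
      have h3 : ∀ i, (2 * q.2 i) ^ 2 = 2 * (2 * q.2 i ^ 2) := fun i => by ring
      rw [hWG]
      simp only [h1, h3, Finset.sum_add_distrib, ← Finset.mul_sum, hδsum]
      omega
    have h3 := hWle q hq
    rw [Nat.odd_iff]
    omega

lemma norm_eC (t : ℝ) : ‖eC t‖ = 1 := by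
  rw [eC, show (2 * Real.pi * Complex.I * t : ℂ) = ((2 * Real.pi * t : ℝ) : ℂ) * Complex.I by
    push_cast; ring]
  exact Complex.norm_exp_ofReal_mul_I _

lemma volume_minorArcs_le (N : ℝ) : volume (minorArcs N) ≤ 1 :=
  (measure_mono Set.sdiff_subset).trans (by simp)

lemma card_box_le (d : ℕ) {N : ℝ} (hN : 1 ≤ N) : ((box d N).card : ℝ) ≤ (2 * N) ^ d := by
  have h0 : 0 ≤ ⌊N⌋ := Int.floor_nonneg.2 (by linarith)
  rw [box, Fintype.card_piFinset_const, Int.card_Icc, Nat.cast_pow]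
  refine pow_le_pow_left₀ (by positivity) ?_ d
  have h1 : (((⌊N⌋ + 1 - 0).toNat : ℤ) : ℝ) = ⌊N⌋ + 1 := by
    rw [Int.toNat_of_nonneg (by omega)]
    push_cast; ring
  rw [Int.cast_natCast] at h1
  rw [h1]
  linarith [Int.floor_le N]

/-- Pointwise bound for the error operator obtained by estimating the exponential sum over `v`
trivially. -/
lemma norm_Eminor_le (d lam : ℕ) (N : ℝ) (f : V d → ℂ) (x : V d) :
    ‖Eminor d lam N f x‖ ≤
      (Ncount d lam : ℝ)⁻¹ * ((box d N).card * ∑ u ∈ box d N, ‖f (x - u)‖) := by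
  rw [Eminor, norm_mul, norm_inv, Complex.norm_natCast]
  refine mul_le_mul_of_nonneg_left ?_ (by positivity)
  have hvol := volume_minorArcs_le N
  refine (norm_setIntegral_le_of_norm_le_const
    (C := (box d N).card * ∑ u ∈ box d N, ‖f (x - u)‖)
    (hvol.trans_lt ENNReal.one_lt_top) fun θ _ => ?_).trans ?_
  · refine (norm_sum_le _ _).trans ?_
    rw [Finset.mul_sum]
    refine Finset.sum_le_sum fun u _ => (norm_sum_le _ _).trans_eq ?_
    simp [norm_eC]
  · refine mul_le_of_le_one_right (by positivity) ?_
    exact ENNReal.toReal_le_of_le_ofReal zero_le_one (by simpa using hvol)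

lemma tsum_sum_sub_eq {d : ℕ} (B : Finset (V d)) (F : V d → ℝ≥0∞) :
    ∑' x, ∑ u ∈ B, F (x - u) = B.card * ∑' x, F x := by
  rw [Summable.tsum_finsetSum fun _ _ => ENNReal.summable, ← nsmul_eq_mul, ← Finset.sum_const]
  exact Finset.sum_congr rfl fun u _ => (Equiv.subRight u).tsum_eq F

/-- Dyadic `l¹` bound for the minor-arc maximal error: for `d ≥ 3` there is
`C = C(d)` so that, with `Λ = 2^j` and `N = Λ^{1/2}`,
`‖sup_{λ ∈ [Λ,2Λ)} |E_{m,λ} f|‖_{l¹} ≤ C N² ‖f‖_{l¹}`. -/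
theorem minor_arc_l1_bound (d : ℕ) (hd : 3 ≤ d) :
    ∃ C : ℝ≥0, ∀ j : ℕ, ∀ f : V d → ℂ,
      lpNormE d 1
        (fun x => ⨆ (lam : ℕ) (_ : 2 ^ j ≤ lam ∧ lam < 2 ^ (j + 1)),
          (‖Eminor d lam (Real.sqrt ((2 : ℝ) ^ j)) f x‖₊ : ℝ≥0∞)) ≤
      C * ENNReal.ofReal (Real.sqrt ((2 : ℝ) ^ j) ^ 2) * lpNorm d 1 f := by
  obtain ⟨e, rfl⟩ : ∃ e, d = e + 2 := ⟨d - 2, by omega⟩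
  refine ⟨4 ^ (e + 2) * (36 * e) ^ e, fun j f => ?_⟩
  set N := Real.sqrt ((2 : ℝ) ^ j) with hN
  have hN2 : N ^ 2 = 2 ^ j := Real.sq_sqrt (by positivity)
  have hN1 : 1 ≤ N := Real.one_le_sqrt.2 (one_le_pow₀ one_le_two)
  set B := ((box (e + 2) N).card : ℝ) with hB
  have hBle : B ≤ (2 * N) ^ (e + 2) := card_box_le _ hN1
  set K : ℝ := (36 * e) ^ e / (N ^ 2) ^ (e + 1) * B with hK
  have hK0 : 0 ≤ K := by positivity
  have hpoint : ∀ x : V (e + 2), (⨆ (lam : ℕ) (_ : 2 ^ j ≤ lam ∧ lam < 2 ^ (j + 1)),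
      (‖Eminor (e + 2) lam N f x‖₊ : ℝ≥0∞)) ≤
      ENNReal.ofReal K * ∑ u ∈ box (e + 2) N, (‖f (x - u)‖₊ : ℝ≥0∞) := by
    intro x
    refine iSup₂_le fun lam hlam => ?_
    have hlam0 : 0 < lam := lt_of_lt_of_le (by positivity) hlam.1
    have hcount : (lam : ℝ) ^ (e + 1) ≤ (36 * e) ^ e * Ncount (e + 2) lam := by
      exact_mod_cast pow_le_mul_Ncount (by omega) hlam0
    have hlamN : (N ^ 2) ^ (e + 1) ≤ (lam : ℝ) ^ (e + 1) := by
      refine pow_le_pow_left₀ (by positivity) ?_ _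
      rw [hN2]
      exact_mod_cast hlam.1
    have hNc : (0 : ℝ) < Ncount (e + 2) lam := by
      rcases (Nat.cast_nonneg (α := ℝ) (Ncount (e + 2) lam)).eq_or_lt with h | h
      · rw [← h, mul_zero] at hcount
        exact absurd hcount (not_le.2 (by positivity))
      · exact h
    have hinv : (Ncount (e + 2) lam : ℝ)⁻¹ ≤ (36 * e) ^ e / (N ^ 2) ^ (e + 1) := by
      rw [inv_eq_one_div, div_le_div_iff₀ hNc (by positivity), one_mul]
      exact hlamN.trans hcount
    have hreal : ‖Eminor (e + 2) lam N f x‖ ≤ K * ∑ u ∈ box (e + 2) N, ‖f (x - u)‖ := by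
      refine (norm_Eminor_le _ _ _ _ _).trans ?_
      rw [hK, mul_assoc]
      exact mul_le_mul_of_nonneg_right hinv (by positivity)
    calc (‖Eminor (e + 2) lam N f x‖₊ : ℝ≥0∞) = ENNReal.ofReal ‖Eminor (e + 2) lam N f x‖ :=
          (ofReal_norm _).symm
      _ ≤ ENNReal.ofReal (K * ∑ u ∈ box (e + 2) N, ‖f (x - u)‖) := ENNReal.ofReal_le_ofReal hreal
      _ = _ := by
        rw [ENNReal.ofReal_mul hK0, ENNReal.ofReal_sum_of_nonneg fun _ _ => norm_nonneg _]
        simp only [ofReal_norm]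
        rfl
  have hKB : K * B ≤ 4 ^ (e + 2) * (36 * e) ^ e * N ^ 2 := by
    have hBB : B * B ≤ 4 ^ (e + 2) * (N ^ 2) ^ (e + 2) := by
      calc B * B ≤ (2 * N) ^ (e + 2) * (2 * N) ^ (e + 2) :=
            mul_le_mul hBle hBle (by positivity) (by positivity)
        _ = ((2 * N) * (2 * N)) ^ (e + 2) := (mul_pow _ _ _).symm
        _ = (4 * N ^ 2) ^ (e + 2) := by ring_nf
        _ = _ := mul_pow _ _ _
    calc K * B = (36 * e) ^ e / (N ^ 2) ^ (e + 1) * (B * B) := by rw [hK]; ring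
      _ ≤ (36 * e) ^ e / (N ^ 2) ^ (e + 1) * (4 ^ (e + 2) * (N ^ 2) ^ (e + 2)) :=
        mul_le_mul_of_nonneg_left hBB (by positivity)
      _ = _ := by
        rw [pow_succ (N ^ 2) (e + 1)]
        field_simp
  simp only [lpNormE, _root_.lpNorm, ENNReal.rpow_one, div_one]
  calc _ ≤ ∑' x, ENNReal.ofReal K * ∑ u ∈ box (e + 2) N, (‖f (x - u)‖₊ : ℝ≥0∞) :=
        ENNReal.tsum_le_tsum hpoint
    _ = ENNReal.ofReal (K * B) * ∑' x, (‖f x‖₊ : ℝ≥0∞) := by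
      rw [ENNReal.tsum_mul_left, tsum_sum_sub_eq _ fun x => (‖f x‖₊ : ℝ≥0∞),
        ENNReal.ofReal_mul hK0, hB, ENNReal.ofReal_natCast, mul_assoc]
    _ ≤ _ := by
      refine mul_le_mul_left ?_ _
      refine (ENNReal.ofReal_le_ofReal hKB).trans_eq ?_
      rw [ENNReal.ofReal_mul (by positivity)]
      congr 1
      rw [← ENNReal.ofReal_coe_nnreal]
      push_cast
      rfl
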